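/- Let G be a dense, K_4^3 ∪ e-free 3-graph with λ(G) > √3/18. Then G is X_2-free, where X_2 is the 3-graph on vertex set {1,...,6} whose edges are the four triples inside {1,2,3,4} and the four triples inside {1,2,5,6} (two copies of K_4^3 sharing the two vertices 1,2). -/

import Mathlib

open Finset

/-- An `r`-uniform hypergraph (r-graph) with vertices drawn from `ℕ`. -/
structure HyperGraph (r : ℕ) where
  verts : Finset ℕ
  edges : Finset (Finset ℕ)
  edges_sub : ∀ e ∈ edges, e ⊆ verts
  card_eq : ∀ e ∈ edges, e.card = r

/-- A 3-uniform hypergraph (3-graph). -/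
abbrev ThreeGraph := HyperGraph 3

/-- A feasible weight vector on `G`: nonnegative weights on the vertices summing to 1. -/
def HyperGraph.IsFeasible {r : ℕ} (G : HyperGraph r) (w : ℕ → ℝ) : Prop :=
  (∀ v ∈ G.verts, 0 ≤ w v) ∧ ∑ v ∈ G.verts, w v = 1

/-- The Lagrangian function `λ(G, w) = Σ_{e ∈ E(G)} Π_{v ∈ e} w v`. -/
noncomputable def HyperGraph.lagFun {r : ℕ} (G : HyperGraph r) (w : ℕ → ℝ) : ℝ :=
  ∑ e ∈ G.edges, ∏ v ∈ e, w v

/-- The Lagrangian `λ(G)`: the maximum of `λ(G, w)` over feasible weight vectors. -/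
noncomputable def HyperGraph.lag {r : ℕ} (G : HyperGraph r) : ℝ :=
  sSup {x : ℝ | ∃ w, G.IsFeasible w ∧ G.lagFun w = x}

/-- `G` contains a copy of `F`: an injection of the vertices of `F` into those of `G`
mapping every edge of `F` to an edge of `G`. -/
def HyperGraph.ContainsCopy {r : ℕ} (G F : HyperGraph r) : Prop :=
  ∃ f : ℕ → ℕ, Set.InjOn f ↑F.verts ∧ (∀ v ∈ F.verts, f v ∈ G.verts) ∧
    ∀ e ∈ F.edges, e.image f ∈ G.edges

/-- `G` is `F`-free. -/
def HyperGraph.Free {r : ℕ} (G F : HyperGraph r) : Prop := ¬ G.ContainsCopy F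

/-- `H` is a subgraph of `G`. -/
def HyperGraph.IsSubgraph {r : ℕ} (H G : HyperGraph r) : Prop :=
  H.verts ⊆ G.verts ∧ H.edges ⊆ G.edges

/-- `G` is dense: every proper subgraph has strictly smaller Lagrangian. -/
def HyperGraph.LagDense {r : ℕ} (G : HyperGraph r) : Prop :=
  ∀ H : HyperGraph r, H.IsSubgraph G → (H.verts ≠ G.verts ∨ H.edges ≠ G.edges) →
    H.lag < G.lag

/-- The Lagrangian density `π_λ(F) = sup { r! · λ(G) : G is F-free }`. -/
noncomputable def lagDensity {r : ℕ} (F : HyperGraph r) : ℝ :=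
  sSup {x : ℝ | ∃ G : HyperGraph r, G.Free F ∧ x = (Nat.factorial r : ℝ) * G.lag}

/-- An optimum weight vector for `G`. -/
def HyperGraph.IsOptimal {r : ℕ} (G : HyperGraph r) (w : ℕ → ℝ) : Prop :=
  G.IsFeasible w ∧ G.lagFun w = G.lag

/-- `K_4^3 ∪ e`: the disjoint union of the complete 3-graph on `{1,2,3,4}`
and the single edge `{5,6,7}`. -/
def K43e : ThreeGraph where
  verts := {1, 2, 3, 4, 5, 6, 7}
  edges := {{1, 2, 3}, {1, 2, 4}, {1, 3, 4}, {2, 3, 4}, {5, 6, 7}}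
  edges_sub := by decide
  card_eq := by decide

/-- `X_2`: two copies of `K_4^3` sharing the two vertices `1, 2`. -/
def X2 : ThreeGraph where
  verts := {1, 2, 3, 4, 5, 6}
  edges := {{1, 2, 3}, {1, 2, 4}, {1, 3, 4}, {2, 3, 4},
    {1, 2, 5}, {1, 2, 6}, {1, 5, 6}, {2, 5, 6}}
  edges_sub := by decide
  card_eq := by decide



lemma polyBase (a r m : ℝ) (ha : 0 ≤ a) (hr : 0 ≤ r) (h : a + r = 1) (hm : 0 ≤ m) (hm2 : m^2 = 1/3) :
    a^2*r/4 + a*r^2/2 ≤ m/6 := by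
  have ha' : a = 1 - r := by linarith
  subst ha'
  have h1 : 0 ≤ (r-m)^2*(r+2*m) := by positivity
  have h2 : (r-m)^2*(r+2*m) = r^3 - 3*m^2*r + 2*m^2*m := by ring
  rw [h2, hm2] at h1
  nlinarith

lemma polyII (a r s m : ℝ) (ha : 0 ≤ a) (hs : 0 ≤ s) (hsr : s ≤ r) (h : a + r = 1) (hm : 0 ≤ m)
    (hm2 : m^2 = 1/3) : a^2*r/4 + a*r^2/2 - a*s^2/8 + s^3/16 ≤ m/6 := by
  by_cases hc : s ≤ 2*a
  · have := polyBase a r m ha (by linarith) h hm hm2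
    nlinarith [mul_nonneg (sq_nonneg s) (sub_nonneg.2 hc)]
  · push Not at hc
    have hm' : (0.5772:ℝ) ≤ m := by nlinarith
    have h1 : s^2*(s-2*a) ≤ r^2*(r-2*a) := by
      have : s^2 ≤ r^2 := by nlinarith
      nlinarith
    have ha' : a = 1 - r := by linarith
    subst ha'
    have h3 : (1-r)^2*r/4 + (1-r)*r^2/2 + r^2*(r-2*(1-r))/16 ≤ 5/54 := by
      nlinarith [mul_nonneg (show 0 ≤ r by linarith) (sq_nonneg (r - 2/3)), sq_nonneg (r-2/3)]
    nlinarith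

lemma polyA (a s : ℝ) (ha : 0 ≤ a) (hs : 0 ≤ s) (h : a + 2*s ≤ 1) :
    a^2*s/2 + a^3/32 + a*(1-a)^2/2 - a*s^2 + s^2*(1-a-2*s) + (2/5)*a*s^2 + (8/15)*s^3 ≤ 0.0962 := by
  nlinarith [mul_nonneg hs (sq_nonneg (s - 0.27)), mul_nonneg ha (sq_nonneg (a - 0.31)),
    mul_nonneg ha (sq_nonneg (s - 0.27)), mul_nonneg hs (sq_nonneg (a - 0.31)), sq_nonneg (a-0.31), sq_nonneg (s-0.27), mul_nonneg ha hs, mul_nonneg (sub_nonneg.2 h) (sq_nonneg (a - 0.31)), mul_nonneg (sub_nonneg.2 h) (sq_nonneg (s - 0.27))]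

lemma polyB (a s : ℝ) (ha : 0 ≤ a) (hs : 0 ≤ s) (ha2 : a ≤ 1/2) (h : a + 2*s ≤ 1) :
    a^2*s/2+7*a^3/64+a*(1-a)^2/2-a*s*s+s*s*(1-a-2*s)+s^3/2+a*(2*s-a/4)^2*(2/19) ≤ 0.0962 := by
  have g1 := mul_nonneg hs (sq_nonneg (s - 0.242))
  have g2 := mul_nonneg ha (sq_nonneg (a - 0.352))
  have g3 := mul_nonneg ha (sq_nonneg (s - 0.242))
  have g4 := mul_nonneg hs (sq_nonneg (a - 0.352))
  have g5 := mul_nonneg (sub_nonneg.2 h) (sq_nonneg (a - 0.352))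
  have g6 := mul_nonneg (sub_nonneg.2 h) (sq_nonneg (s - 0.242))
  have g7 := mul_nonneg (sub_nonneg.2 h) (sq_nonneg (s - 0.242+a-0.352))
  have g8 := mul_nonneg hs (sq_nonneg (s - 0.242+a-0.352))
  have g9 := mul_nonneg ha (sq_nonneg (s - 0.242+a-0.352))
  have k7 := mul_nonneg (sub_nonneg.2 ha2) (sq_nonneg (s - 0.242+a-0.352))
  have k8 := mul_nonneg (sub_nonneg.2 ha2) (sq_nonneg (s - 0.242))
  have k9 := mul_nonneg (sub_nonneg.2 ha2) (sq_nonneg (a-0.352))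
  have j7 := mul_nonneg (sub_nonneg.2 ha2) (sq_nonneg (s - 0.242+(a-0.352)/2))
  have j8 := mul_nonneg (sub_nonneg.2 h) (sq_nonneg (s - 0.242+(a-0.352)/2))
  have j9 := mul_nonneg ha (sq_nonneg (s - 0.242+(a-0.352)/2))
  have j1 := mul_nonneg hs (sq_nonneg (s - 0.242+(a-0.352)/2))
  have l1 := mul_nonneg (mul_nonneg hs ha) (sub_nonneg.2 h)
  have l2 := mul_nonneg (mul_nonneg hs hs) (sub_nonneg.2 h)
  have l3 := mul_nonneg (mul_nonneg ha ha) (sub_nonneg.2 h)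
  have l4 := mul_nonneg (mul_nonneg hs ha) (sub_nonneg.2 ha2)
  have l5 := mul_nonneg (mul_nonneg hs hs) (sub_nonneg.2 ha2)
  have l6 := mul_nonneg (mul_nonneg ha ha) (sub_nonneg.2 ha2)
  linarith

lemma polyC (a s : ℝ) (hs : 0 ≤ s) (ha2 : 1/2 ≤ a) (h : a + 2*s ≤ 1) :
    a*(1-a)*(2-a)/4+s^2*(1-3/2*a-3/2*s) ≤ 0.0962 := by
  have h1 : s^2*(1-3/2*a-3/2*s) ≤ s^2*(1/4-3/2*s) := by nlinarith [sq_nonneg s]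
  have h2 : s^2*(1/4-3/2*s) ≤ 0.0011 := by nlinarith [mul_nonneg hs (sq_nonneg (s-1/9)), sq_nonneg (s-1/9)]
  have h3 : a*(1-a)*(2-a)/4 ≤ 0.09375 := by nlinarith [mul_nonneg (sub_nonneg.2 ha2) (sub_nonneg.2 ha2), mul_nonneg (mul_nonneg (sub_nonneg.2 ha2) (sub_nonneg.2 ha2)) (show 0 ≤ 1 - a by linarith)]
  linarith

set_option maxHeartbeats 1000000 in
lemma polyI (p q α β u z y : ℝ) (hp : 0 ≤ p) (hq : 0 ≤ q) (hα : 0 ≤ α) (hβ : 0 ≤ β) (hu : 0 ≤ u)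
    (hz : 0 ≤ z) (hy : 0 ≤ y) (hqp : q ≤ p) (hsum : p + q + 2*α + 2*β + u + z + y = 1) :
    p*q*(2*α+2*β+u+z) + (p+q)*((2*α+2*β+u+z+y)^2 - 2*α^2 - 2*β^2 - u^2)/2
      + (α+β)^2*(u+z+y) + 2*α*β*(α+β) - q*(β^2+2*β*z+z^2/2) ≤ 0.0962 := by
  obtain ⟨a, ha⟩ : ∃ a, a = p + q := ⟨_, rfl⟩
  obtain ⟨d, hd⟩ : ∃ d, d = (p - q)/2 := ⟨_, rfl⟩
  obtain ⟨s, hs⟩ : ∃ s, s = α + β := ⟨_, rfl⟩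
  have hp' : p = a/2 + d := by linarith
  have hq' : q = a/2 - d := by linarith
  have hα' : α = s - β := by linarith
  have hd0 : 0 ≤ d := by linarith
  have ha0 : 0 ≤ a := by linarith
  have hs0 : 0 ≤ s := by linarith
  have hβs : β ≤ s := by linarith
  have hy' : y = 1 - a - 2*s - u - z := by linarith
  have hz1 : a + 2*s ≤ 1 := by linarith
  have hpq : p*q = a^2/4 - d^2 := by rw [hp', hq']; ring
  have hpq4 : p*q ≤ a^2/4 := by rw [hpq]; nlinarith [sq_nonneg d]
  have hu1 : p*q*u - a*u^2/2 ≤ a^3/32 := by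
    nlinarith [mul_le_mul_of_nonneg_right hpq4 hu, mul_nonneg ha0 (sq_nonneg (u - a/4))]
  have hF : p*q*(2*α+2*β+u+z) + (p+q)*((2*α+2*β+u+z+y)^2 - 2*α^2 - 2*β^2 - u^2)/2
      + (α+β)^2*(u+z+y) + 2*α*β*(α+β) - q*(β^2+2*β*z+z^2/2)
      = 2*(p*q)*s + (p*q*u - a*u^2/2) + a*(1-a)^2/2 - a*((s-β)^2+β^2)
        + s^2*(1-a-2*s) + 2*(s-β)*β*s - q*β^2 + q*(p*z-2*β*z-z^2/2) := by
    rw [hy', hα', ← ha]; ring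
  rw [hF]
  by_cases hc : p ≤ 2*β
  · have hJ : q*(p*z-2*β*z-z^2/2) ≤ 0 := by
      have : p*z-2*β*z-z^2/2 ≤ 0 := by nlinarith [mul_nonneg hz (sub_nonneg.2 hc), sq_nonneg z]
      nlinarith
    have h1 : 2*(p*q)*s - q*β^2 ≤ a^2*s/2 - a*β^2/2 + s*β^2/8 := by
      rw [hpq, hq']
      nlinarith [mul_nonneg hs0 (sq_nonneg (β - 4*d)), mul_nonneg (mul_nonneg hd0 hβ) (sub_nonneg.2 hβs)]
    have h2 := polyA a s ha0 hs0 hz1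
    have h3 := mul_nonneg ha0 (sq_nonneg (β - 2/5*s))
    have h4 := mul_nonneg hs0 (sq_nonneg (β - 8/15*s))
    have h5 : - a*((s-β)^2+β^2) + 2*(s-β)*β*s - a*β^2/2 + s*β^2/8 =
      - a*s^2 + (2/5)*a*s^2 + (8/15)*s^3 - 5/2*(a*(β - 2/5*s)^2) - 15/8*(s*(β - 8/15*s)^2) := by ring
    linarith
  · push Not at hc
    have hJ : q*(p*z-2*β*z-z^2/2) ≤ (p*q)*(p-2*β)/2 := by
      have : p*z-2*β*z-z^2/2 ≤ p*(p-2*β)/2 := by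
        nlinarith [sq_nonneg (z - (p-2*β)), mul_nonneg hβ (sub_nonneg.2 hc.le)]
      calc _ ≤ q*(p*(p-2*β)/2) := mul_le_mul_of_nonneg_left this hq
        _ = _ := by ring
    by_cases ha2 : a ≤ 1/2
    · have hβ2 : β^2 ≤ a*s/2 := by
        have : β ≤ a/2 := by linarith
        nlinarith [mul_nonneg hβ (sub_nonneg.2 this), mul_nonneg ha0 (sub_nonneg.2 hβs)]
      obtain ⟨X, hX⟩ : ∃ X, X = a^2/8+β^2 := ⟨_, rfl⟩
      have hX0 : 0 ≤ X := by rw [hX]; positivity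
      have hXY : 2*X ≤ a*(s+a/4) := by rw [hX]; nlinarith
      have hg : d*X - d^2*(s+a/4) ≤ X*a/8 := by
        rcases ha0.eq_or_lt with h0 | h0
        · have : d = 0 := by linarith
          subst this; rw [← h0]; simp
        · have e1 : a*(d*X - d^2*(s+a/4)) ≤ a*(X*a/8) := by
            nlinarith [mul_nonneg hX0 (sq_nonneg (a - 4*d)), mul_le_mul_of_nonneg_left hXY (sq_nonneg d)]
          exact le_of_mul_le_mul_left e1 h0
      have h1 : 2*(p*q)*s - q*β^2 + (p*q)*(p-2*β)/2 ≤
          a^2*s/2 + a^3/16 - a^2*β/4 - a*β^2/2 + X*a/8 := by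
        have e : 2*(p*q)*s - q*β^2 + (p*q)*(p-2*β)/2 =
          a^2*s/2 + a^3/16 - a^2*β/4 - a*β^2/2 + (d*X - d^2*(s+a/4)) - d^2*(s-β) - d^3/2 := by
          rw [hpq, hq', hp', hX]; ring
        rw [e]
        have e3 := mul_nonneg (sq_nonneg d) (sub_nonneg.2 hβs)
        have e4 := pow_nonneg hd0 3
        linarith
      have h2 := polyB a s ha0 hs0 ha2 hz1
      rw [hX] at h1
      have h3 : 0 ≤ a*(19/8)*(β - (2*s-a/4)*(4/19))^2 := by positivity
      have h4 : 0 ≤ 2*s*(β - s/2)^2 := by positivity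
      have h5 : - a*((s-β)^2+β^2) + 2*(s-β)*β*s - a^2*β/4 - a*β^2/2 + (a^2/8+β^2)*a/8 =
        - a*s*s + s^3/2 + a*(2*s-a/4)^2*(2/19) + a^3/64 - a*(19/8)*(β - (2*s-a/4)*(4/19))^2
        - 2*s*(β - s/2)^2 := by ring
      linarith
    · push Not at ha2
      have h1 : 2*(p*q)*s + p*q*u + q*(p*z-2*β*z-z^2/2) ≤ a^2/4*(1-a) := by
        have e1 : 0 ≤ q*(2*β*z+z^2/2) := by positivity
        have e2 : p*q*(2*s+u+z) ≤ a^2/4*(1-a) :=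
          mul_le_mul hpq4 (by linarith) (by linarith) (by positivity)
        linarith
      have h2 := polyC a s hs0 ha2.le hz1
      have h3 := mul_nonneg ha0 (sq_nonneg (s-2*β))
      have h4 := mul_nonneg hs0 (sq_nonneg (s-2*β))
      have h5 := mul_nonneg ha0 (sq_nonneg u)
      have h6 := mul_nonneg hq (sq_nonneg β)
      have h7 : - a*((s-β)^2+β^2) + 2*(s-β)*β*s = -a*s^2/2 + s^3/2 - 1/2*(a*(s-2*β)^2) - 1/2*(s*(s-2*β)^2) := by ring
      linarith

lemma finI (p q w3 w4 w5 w6 u z y zz yy S S0 ER EQ : ℝ) (hp : 0 ≤ p) (hq : 0 ≤ q)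
    (h3 : 0 ≤ w3) (h4 : 0 ≤ w4) (h5 : 0 ≤ w5) (h6 : 0 ≤ w6) (hu : 0 ≤ u) (hz : 0 ≤ z) (hy : 0 ≤ y)
    (hzz : 0 ≤ zz) (hyy : 0 ≤ yy) (hqp : q ≤ p)
    (hsum : 1 = p + (q + (w3 + (w4 + (w5 + (w6 + (u + (z + y))))))))
    (hR : 2 * ER = (w3 + (w4 + (w5 + (w6 + (u + (z + y))))))^2
      - (w3^2 + (w4^2 + (w5^2 + (w6^2 + (u^2 + (zz + yy)))))))
    (hQ : 2 * EQ = (w4 + (w6 + z))^2 - (w4^2 + (w6^2 + zz)))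
    (hS0 : S0 ≤ (w3 + w4) * (w5 + w6) * (u + (z + y)) + w3 * w4 * (w5 + w6) + w5 * w6 * (w3 + w4))
    (hS : S ≤ p * q * (w3 + (w4 + (w5 + (w6 + (u + z))))) + (p + q) * ER - q * EQ + S0) :
    S ≤ 0.0962 := by
  have key := polyI p q ((w3+w5)/2) ((w4+w6)/2) u z y hp hq (by positivity) (by positivity) hu hz hy hqp
    (by linarith)
  have g1 : 0 ≤ p*zz := by positivity
  have g2 : 0 ≤ (p+q)*yy := by positivity
  have g3 : 0 ≤ (p+q)*(w3-w5)^2 := by positivity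
  have g4 : 0 ≤ p*(w4-w6)^2 := by positivity
  have g5 : 0 ≤ (u+z+y)*(w3-w5+w4-w6)^2 := by positivity
  have g6 : 0 ≤ (w4+w6)*(w3-w5)^2 := by positivity
  have g7 : 0 ≤ (w3+w5)*(w4-w6)^2 := by positivity
  have hER : ER = ((w3 + (w4 + (w5 + (w6 + (u + (z + y))))))^2
      - (w3^2 + (w4^2 + (w5^2 + (w6^2 + (u^2 + (zz + yy)))))))/2 := by linarith
  have hEQ : EQ = ((w4 + (w6 + z))^2 - (w4^2 + (w6^2 + zz)))/2 := by linarith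
  rw [hER, hEQ] at hS
  linarith

lemma finII (p q w3 w4 w5 w6 t tt S S0 ER : ℝ) (hp : 0 ≤ p) (hq : 0 ≤ q)
    (h3 : 0 ≤ w3) (h4 : 0 ≤ w4) (h5 : 0 ≤ w5) (h6 : 0 ≤ w6) (ht : 0 ≤ t) (htt : 0 ≤ tt)
    (hsum : 1 = p + (q + (w3 + (w4 + (w5 + (w6 + t))))))
    (hR : 2 * ER = (w3 + (w4 + (w5 + (w6 + t))))^2 - (w3^2 + (w4^2 + (w5^2 + (w6^2 + tt)))))
    (hS0 : S0 ≤ (w3 + w4) * (w5 + w6) * 0 + w3 * w4 * (w5 + w6) + w5 * w6 * (w3 + w4))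
    (hS : S ≤ p * q * (w3 + (w4 + (w5 + (w6 + t)))) + (p + q) * ER - q * 0 + S0) :
    S ≤ Real.sqrt 3 / 18 := by
  obtain ⟨r, hr⟩ : ∃ r, r = w3 + (w4 + (w5 + (w6 + t))) := ⟨_, rfl⟩
  obtain ⟨s, hs⟩ : ∃ s, s = w3 + w4 + w5 + w6 := ⟨_, rfl⟩
  obtain ⟨a, ha⟩ : ∃ a, a = p + q := ⟨_, rfl⟩
  have hm2 : (Real.sqrt 3 / 3)^2 = 1/3 := by
    rw [div_pow, Real.sq_sqrt (by norm_num)]; norm_num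
  have key := polyII a r s (Real.sqrt 3 / 3) (by linarith) (by linarith) (by linarith) (by linarith)
    (by positivity) hm2
  have r0 : 0 ≤ r := by linarith
  have a0 : 0 ≤ a := by linarith
  have g1 : p*q*r ≤ a^2*r/4 := by
    rw [ha]; nlinarith [mul_nonneg r0 (sq_nonneg (p-q))]
  have g2 : ER ≤ r^2/2 - s^2/8 := by
    rw [← hr] at hR
    rw [hs]
    nlinarith [sq_nonneg (w3-w4), sq_nonneg (w3-w5), sq_nonneg (w3-w6), sq_nonneg (w4-w5),
      sq_nonneg (w4-w6), sq_nonneg (w5-w6)]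
  have g3 : a*ER ≤ a*(r^2/2 - s^2/8) := mul_le_mul_of_nonneg_left g2 a0
  have g4 : w3 * w4 * (w5 + w6) + w5 * w6 * (w3 + w4) ≤ s^3/16 := by
    have f1 := mul_nonneg (add_nonneg h5 h6) (sq_nonneg (w3-w4))
    have f2 := mul_nonneg (add_nonneg h3 h4) (sq_nonneg (w5-w6))
    have f3 : 0 ≤ s*(w3+w4-w5-w6)^2 := by rw [hs]; positivity
    rw [hs] at f3 ⊢
    linarith
  rw [← hr, ← ha] at hS
  linarith

noncomputable def wt (w : ℕ → ℝ) (e : Finset ℕ) : ℝ := ∏ v ∈ e, w v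

noncomputable def esum2 (w : ℕ → ℝ) (X : Finset ℕ) : ℝ := ∑ π ∈ X.powersetCard 2, wt w π

lemma wt_nonneg (w : ℕ → ℝ) (hw : ∀ v, 0 ≤ w v) (e : Finset ℕ) : 0 ≤ wt w e :=
  Finset.prod_nonneg fun v _ => hw v

lemma wt_insert (w : ℕ → ℝ) (x : ℕ) (e : Finset ℕ) (h : x ∉ e) : wt w (insert x e) = w x * wt w e :=
  Finset.prod_insert h

lemma esum2_eq (w : ℕ → ℝ) (X : Finset ℕ) :
    2 * esum2 w X = (∑ v ∈ X, w v)^2 - ∑ v ∈ X, (w v)^2 := by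
  induction X using Finset.induction_on with
  | empty => simp [esum2, Finset.powersetCard_eq_empty.2 (show (∅ : Finset ℕ).card < 2 by simp)]
  | insert a s ha ih =>
    have h1 : esum2 w (insert a s) = esum2 w s + w a * ∑ v ∈ s, w v := by
      unfold esum2
      rw [Finset.powersetCard_succ_insert ha, Finset.sum_union, Finset.sum_image, Finset.mul_sum]
      · congr 1
        rw [Finset.powersetCard_one, Finset.sum_map]
        refine Finset.sum_congr rfl fun v hv => ?_
        simp only [Function.Embedding.coeFn_mk]
        rw [wt_insert _ _ _ (by simp; rintro rfl; exact ha hv)]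
        simp [wt]
      · intro x hx y hy hxy
        have hx' : a ∉ x := fun h => ha ((Finset.mem_powersetCard.1 hx).1 h)
        have hy' : a ∉ y := fun h => ha ((Finset.mem_powersetCard.1 hy).1 h)
        rw [← Finset.erase_insert hx', ← Finset.erase_insert hy']
        exact congrArg (fun s => s.erase a) hxy
      · rw [Finset.disjoint_left]
        intro x hx hx2
        obtain ⟨y, _, rfl⟩ := Finset.mem_image.1 hx2
        exact ha ((Finset.mem_powersetCard.1 hx).1 (Finset.mem_insert_self _ _))
    rw [h1, Finset.sum_insert ha, Finset.sum_insert ha]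
    linarith [ih]

lemma sum_le_image {ι : Type*} [DecidableEq ι] [Nonempty ι] (w : ℕ → ℝ) (hw : ∀ v, 0 ≤ w v) (D : Finset (Finset ℕ))
    (I : Finset ι) (g : ι → Finset ℕ) (h : D ⊆ I.image g) :
    ∑ e ∈ D, wt w e ≤ ∑ i ∈ I, wt w (g i) := by
  have : ∀ e ∈ D, ∃ i ∈ I, g i = e := fun e he => Finset.mem_image.1 (h he)
  choose! f hf using this
  calc ∑ e ∈ D, wt w e = ∑ e ∈ D, wt w (g (f e)) := Finset.sum_congr rfl fun e he => by rw [(hf e he).2]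
    _ = ∑ i ∈ D.image f, wt w (g i) := by
      rw [Finset.sum_image]
      intro x hx y hy hxy
      rw [← (hf x hx).2, ← (hf y hy).2, hxy]
    _ ≤ _ := Finset.sum_le_sum_of_subset_of_nonneg
      (by intro i hi; obtain ⟨e, he, rfl⟩ := Finset.mem_image.1 hi; exact (hf e he).1)
      (fun _ _ _ => wt_nonneg w hw _)

/-- Upper bound for the Lagrangian polynomial by splitting the edges according to `x1, x2`. -/
lemma split_bound (w : ℕ → ℝ) (hw : ∀ v, 0 ≤ w v) (V : Finset ℕ) (E : Finset (Finset ℕ))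
    (hsub : ∀ e ∈ E, e ⊆ V) (hcard : ∀ e ∈ E, e.card = 3) (x1 x2 : ℕ) (hx : x1 ≠ x2)
    (R N Q : Finset ℕ) (hR : ∀ v, v ∈ R ↔ v ∈ V ∧ v ≠ x1 ∧ v ≠ x2)
    (hN : ∀ v, {x1, x2, v} ∈ E → v ∈ N) (hQR : Q ⊆ R) (hq : w x2 ≤ w x1)
    (hQ : ∀ u ∈ Q, ∀ v ∈ Q, u ≠ v → ¬ ({x1, u, v} ∈ E ∧ {x2, u, v} ∈ E)) :
    ∑ e ∈ E, wt w e ≤ w x1 * w x2 * ∑ v ∈ N, w v + (w x1 + w x2) * esum2 w R - w x2 * esum2 w Q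
      + ∑ e ∈ E.filter (fun e => x1 ∉ e ∧ x2 ∉ e), wt w e := by
  classical
  have hR1 : x1 ∉ R := by simp [hR]
  have hR2 : x2 ∉ R := by simp [hR]
  have s1 : ∑ e ∈ E, wt w e = (∑ e ∈ E with x1 ∈ e ∧ x2 ∈ e, wt w e)
      + (∑ e ∈ E with x1 ∈ e ∧ x2 ∉ e, wt w e) + (∑ e ∈ E with x1 ∉ e ∧ x2 ∈ e, wt w e)
      + ∑ e ∈ E with x1 ∉ e ∧ x2 ∉ e, wt w e := by
    rw [← Finset.sum_filter_add_sum_filter_not E (fun e => x1 ∈ e),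
      ← Finset.sum_filter_add_sum_filter_not (E.filter (fun e => x1 ∈ e)) (fun e => x2 ∈ e),
      ← Finset.sum_filter_add_sum_filter_not (E.filter (fun e => x1 ∉ e)) (fun e => x2 ∈ e)]
    simp only [Finset.filter_filter]
    ring
  have hA : (∑ e ∈ E with x1 ∈ e ∧ x2 ∈ e, wt w e) ≤ w x1 * w x2 * ∑ v ∈ N, w v := by
    rw [Finset.mul_sum]
    have key : (E.filter fun e => x1 ∈ e ∧ x2 ∈ e) ⊆ (N.filter fun v => v ≠ x1 ∧ v ≠ x2).image fun v => {x1, x2, v} := by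
      intro e he
      simp only [Finset.mem_filter] at he
      obtain ⟨he, h1, h2⟩ := he
      have c1 : ((e.erase x1).erase x2).card = 1 := by
        rw [Finset.card_erase_of_mem (by simp [h2, hx.symm]), Finset.card_erase_of_mem h1, hcard e he]
      obtain ⟨v, hv⟩ := Finset.card_eq_one.1 c1
      have hv' : v ∈ (e.erase x1).erase x2 := by rw [hv]; simp
      simp only [Finset.mem_erase] at hv'
      have ee : e = {x1, x2, v} := by
        rw [← Finset.insert_erase h1, ← Finset.insert_erase (show x2 ∈ e.erase x1 by simp [h2, hx.symm]), hv]
      refine Finset.mem_image.2 ⟨v, ?_, ee.symm⟩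
      simp only [Finset.mem_filter]
      exact ⟨hN v (ee ▸ he), hv'.2.1, hv'.1⟩
    refine (sum_le_image w hw _ _ _ key).trans ?_
    calc _ = ∑ v ∈ N with v ≠ x1 ∧ v ≠ x2, w x1 * w x2 * w v := by
          refine Finset.sum_congr rfl fun v hv => ?_
          simp only [Finset.mem_filter] at hv
          rw [wt_insert _ _ _ (by simp [hx, hv.2.1.symm]), wt_insert _ _ _ (by simp [hv.2.2.symm])]
          simp [wt]; ring
      _ ≤ _ := Finset.sum_le_sum_of_subset_of_nonneg (Finset.filter_subset _ _)
          (fun v _ _ => by have := hw x1; have := hw x2; have := hw v; positivity)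
  have hB : ∀ x y, x ∈ ({x1, x2} : Finset ℕ) → (∀ v, v ≠ x → v ≠ y → v ≠ x1 ∧ v ≠ x2) → x ∉ R →
      (∑ e ∈ E with x ∈ e ∧ y ∉ e, wt w e) ≤
        ∑ π ∈ R.powersetCard 2, if insert x π ∈ E then w x * wt w π else 0 := by
    intro x y hx' hxy hxR
    rw [← Finset.sum_filter]
    have key : (E.filter fun e => x ∈ e ∧ y ∉ e) ⊆
        ((R.powersetCard 2).filter fun π => insert x π ∈ E).image fun π => insert x π := by
      intro e he
      simp only [Finset.mem_filter] at he
      obtain ⟨he, h1, h2⟩ := he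
      refine Finset.mem_image.2 ⟨e.erase x, ?_, Finset.insert_erase h1⟩
      simp only [Finset.mem_filter, Finset.mem_powersetCard, Finset.insert_erase h1]
      refine ⟨⟨?_, ?_⟩, he⟩
      · intro v hv
        simp only [Finset.mem_erase] at hv
        exact (hR v).2 ⟨hsub e he hv.2, hxy v hv.1 (fun h => h2 (h ▸ hv.2))⟩
      · rw [Finset.card_erase_of_mem h1, hcard e he]
    refine (sum_le_image w hw _ _ _ key).trans (le_of_eq ?_)
    refine Finset.sum_congr rfl fun π hπ => ?_
    simp only [Finset.mem_filter, Finset.mem_powersetCard] at hπ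
    exact wt_insert _ _ _ (fun h => hxR (hπ.1.1 h))
  have hB1 := hB x1 x2 (by simp) (fun v a b => ⟨a, b⟩) hR1
  have hB2 := hB x2 x1 (by simp) (fun v a b => ⟨b, a⟩) hR2
  have hsw : (E.filter fun e => x1 ∉ e ∧ x2 ∈ e) = E.filter fun e => x2 ∈ e ∧ x1 ∉ e := by
    refine Finset.filter_congr fun e _ => ?_
    tauto
  have hC : (∑ π ∈ R.powersetCard 2, if insert x1 π ∈ E then w x1 * wt w π else 0)
      + (∑ π ∈ R.powersetCard 2, if insert x2 π ∈ E then w x2 * wt w π else 0)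
      ≤ (w x1 + w x2) * esum2 w R - w x2 * esum2 w Q := by
    have e1 : esum2 w Q = ∑ π ∈ R.powersetCard 2, if π ⊆ Q then wt w π else 0 := by
      rw [← Finset.sum_filter]
      unfold esum2
      congr 1
      ext π
      simp only [Finset.mem_filter, Finset.mem_powersetCard]
      constructor
      · rintro ⟨a, b⟩; exact ⟨⟨a.trans hQR, b⟩, a⟩
      · rintro ⟨⟨_, b⟩, a⟩; exact ⟨a, b⟩
    rw [e1]
    unfold esum2
    rw [Finset.mul_sum, Finset.mul_sum, ← Finset.sum_add_distrib, ← Finset.sum_sub_distrib]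
    refine Finset.sum_le_sum fun π hπ => ?_
    have hn := wt_nonneg w hw π
    have h1 := mul_nonneg (hw x1) hn
    have h2 := mul_nonneg (hw x2) hn
    have h3 := mul_le_mul_of_nonneg_right hq hn
    by_cases hπQ : π ⊆ Q
    · have : ¬ (insert x1 π ∈ E ∧ insert x2 π ∈ E) := by
        obtain ⟨u, v, huv, rfl⟩ := Finset.card_eq_two.1 (Finset.mem_powersetCard.1 hπ).2
        exact hQ u (hπQ (by simp)) v (hπQ (by simp)) huv
      rw [if_pos hπQ]
      split_ifs with c1 c2 c2
      · exact absurd ⟨c1, c2⟩ this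
      all_goals linarith
    · rw [if_neg hπQ]
      split_ifs <;> linarith
  rw [s1, hsw]
  linarith

lemma wt_triple (w : ℕ → ℝ) (a b c : ℕ) (h1 : a ≠ b) (h2 : a ≠ c) (h3 : b ≠ c) :
    wt w {a, b, c} = w a * w b * w c := by
  rw [wt_insert _ _ _ (by simp [h1, h2]), wt_insert _ _ _ (by simp [h3])]
  simp [wt]; ring

lemma triple_eq (e : Finset ℕ) (he : e.card = 3) (a b c : ℕ) (ha : a ∈ e) (hb : b ∈ e) (hc : c ∈ e)
    (h1 : a ≠ b) (h2 : a ≠ c) (h3 : b ≠ c) : {a, b, c} = e := by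
  apply Finset.eq_of_subset_of_card_le
  · intro v hv
    simp only [Finset.mem_insert, Finset.mem_singleton] at hv
    rcases hv with rfl | rfl | rfl <;> assumption
  · rw [he, Finset.card_eq_three.2 ⟨a, b, c, h1, h2, h3, rfl⟩]

/-- Bound for the edges avoiding `x1, x2`. -/
lemma e0_bound (w : ℕ → ℝ) (hw : ∀ v, 0 ≤ w v) (D : Finset (Finset ℕ)) (T : Finset ℕ)
    (x3 x4 x5 x6 : ℕ) (h34 : x3 ≠ x4) (h35 : x3 ≠ x5) (h36 : x3 ≠ x6) (h45 : x4 ≠ x5)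
    (h46 : x4 ≠ x6) (h56 : x5 ≠ x6) (hT3 : x3 ∉ T) (hT4 : x4 ∉ T) (hT5 : x5 ∉ T) (hT6 : x6 ∉ T)
    (hcard : ∀ e ∈ D, e.card = 3)
    (hel : ∀ e ∈ D, ∀ v ∈ e, v ∈ T ∨ v = x3 ∨ v = x4 ∨ v = x5 ∨ v = x6)
    (hm1 : ∀ e ∈ D, x3 ∈ e ∨ x4 ∈ e) (hm2 : ∀ e ∈ D, x5 ∈ e ∨ x6 ∈ e) :
    ∑ e ∈ D, wt w e ≤ (w x3 + w x4) * (w x5 + w x6) * (∑ v ∈ T, w v)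
      + w x3 * w x4 * (w x5 + w x6) + w x5 * w x6 * (w x3 + w x4) := by
  classical
  rw [← Finset.sum_filter_add_sum_filter_not D (fun e => ∃ v ∈ e, v ∈ T),
      ← Finset.sum_filter_add_sum_filter_not (D.filter (fun e => ¬ ∃ v ∈ e, v ∈ T)) (fun e => x3 ∈ e ∧ x4 ∈ e),
      ← add_assoc]
  refine add_le_add (add_le_add ?_ ?_) ?_
  · have key : (D.filter fun e => ∃ v ∈ e, v ∈ T) ⊆
        ((({x3, x4} : Finset ℕ) ×ˢ ({x5, x6} : Finset ℕ)) ×ˢ T).image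
          (fun i => ({i.1.1, i.1.2, i.2} : Finset ℕ)) := by
      intro e he
      simp only [Finset.mem_filter] at he
      obtain ⟨he, x, hxe, hxT⟩ := he
      obtain ⟨i, hi, hie⟩ : ∃ i ∈ ({x3, x4} : Finset ℕ), i ∈ e := by
        rcases hm1 e he with h | h
        · exact ⟨x3, by simp, h⟩
        · exact ⟨x4, by simp, h⟩
      obtain ⟨j, hj, hje⟩ : ∃ j ∈ ({x5, x6} : Finset ℕ), j ∈ e := by
        rcases hm2 e he with h | h
        · exact ⟨x5, by simp, h⟩
        · exact ⟨x6, by simp, h⟩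
      refine Finset.mem_image.2 ⟨((i, j), x), by simp only [Finset.mem_product]; exact ⟨⟨hi, hj⟩, hxT⟩, ?_⟩
      simp only [Finset.mem_insert, Finset.mem_singleton] at hi hj
      apply triple_eq e (hcard e he) i j x hie hje hxe
      · rcases hi with rfl | rfl <;> rcases hj with rfl | rfl <;> assumption
      · rintro rfl; rcases hi with rfl | rfl <;> contradiction
      · rintro rfl; rcases hj with rfl | rfl <;> contradiction
    refine (sum_le_image w hw _ _ _ key).trans (le_of_eq ?_)
    have : ∀ i ∈ (({x3, x4} : Finset ℕ) ×ˢ ({x5, x6} : Finset ℕ)) ×ˢ T,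
        wt w ({i.1.1, i.1.2, i.2} : Finset ℕ) = w i.1.1 * w i.1.2 * w i.2 := by
      rintro ⟨⟨i, j⟩, x⟩ h
      simp only [Finset.mem_product, Finset.mem_insert, Finset.mem_singleton] at h
      obtain ⟨⟨hi, hj⟩, hxT⟩ := h
      change wt w {i, j, x} = w i * w j * w x
      apply wt_triple
      · rcases hi with rfl | rfl <;> rcases hj with rfl | rfl <;> assumption
      · rintro rfl; rcases hi with rfl | rfl <;> contradiction
      · rintro rfl; rcases hj with rfl | rfl <;> contradiction
    rw [Finset.sum_congr rfl this, Finset.sum_product, Finset.sum_product]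
    simp only [Finset.sum_pair h34, Finset.sum_pair h56, ← Finset.mul_sum]
    ring
  · have key : ((D.filter fun e => ¬ ∃ v ∈ e, v ∈ T).filter fun e => x3 ∈ e ∧ x4 ∈ e) ⊆
        ({x5, x6} : Finset ℕ).image (fun j => ({x3, x4, j} : Finset ℕ)) := by
      intro e he
      simp only [Finset.mem_filter] at he
      obtain ⟨⟨he, _⟩, a3, a4⟩ := he
      rcases hm2 e he with h | h
      · exact Finset.mem_image.2 ⟨x5, by simp, triple_eq e (hcard e he) _ _ _ a3 a4 h h34 h35 h45⟩
      · exact Finset.mem_image.2 ⟨x6, by simp, triple_eq e (hcard e he) _ _ _ a3 a4 h h34 h36 h46⟩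
    refine (sum_le_image w hw _ _ _ key).trans (le_of_eq ?_)
    rw [Finset.sum_pair h56, wt_triple _ _ _ _ h34 h35 h45, wt_triple _ _ _ _ h34 h36 h46]
    ring
  · have key : ((D.filter fun e => ¬ ∃ v ∈ e, v ∈ T).filter fun e => ¬ (x3 ∈ e ∧ x4 ∈ e)) ⊆
        ({x3, x4} : Finset ℕ).image (fun j => ({j, x5, x6} : Finset ℕ)) := by
      intro e he
      simp only [Finset.mem_filter] at he
      obtain ⟨⟨he, hnT⟩, hn⟩ := he
      obtain ⟨i, hi, hsub⟩ : ∃ i ∈ ({x3, x4} : Finset ℕ), e ⊆ {i, x5, x6} := by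
        by_cases h3 : x3 ∈ e
        · refine ⟨x3, by simp, fun v hv => ?_⟩
          have h4 : x4 ∉ e := fun h => hn ⟨h3, h⟩
          rcases hel e he v hv with h | h | h | h | h
          · exact absurd ⟨v, hv, h⟩ hnT
          · simp [h]
          · exact absurd (h ▸ hv) h4
          · simp [h]
          · simp [h]
        · refine ⟨x4, by simp, fun v hv => ?_⟩
          rcases hel e he v hv with h | h | h | h | h
          · exact absurd ⟨v, hv, h⟩ hnT
          · exact absurd (h ▸ hv) h3
          · simp [h]
          · simp [h]
          · simp [h]
      refine Finset.mem_image.2 ⟨i, hi, (Finset.eq_of_subset_of_card_le hsub ?_).symm⟩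
      rw [hcard e he]
      exact Finset.card_le_three
    refine (sum_le_image w hw _ _ _ key).trans (le_of_eq ?_)
    rw [Finset.sum_pair h34, wt_triple _ _ _ _ h35 h36 h56, wt_triple _ _ _ _ h45 h46 h56]
    ring

/-- The case in which some edge avoiding `x1, x2` leaves the six vertices. -/
lemma caseI (w : ℕ → ℝ) (hw : ∀ v, 0 ≤ w v) (V : Finset ℕ) (E : Finset (Finset ℕ))
    (hsub : ∀ e ∈ E, e ⊆ V) (hcard : ∀ e ∈ E, e.card = 3) (hsum : ∑ v ∈ V, w v = 1)
    (hK : ∀ a b c d, {a, b, c} ∈ E → {a, b, d} ∈ E → {a, c, d} ∈ E → {b, c, d} ∈ E →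
      ∀ e ∈ E, a ∈ e ∨ b ∈ e ∨ c ∈ e ∨ d ∈ e)
    (x1 x2 x3 x4 x5 x6 x7 : ℕ) (hnd : [x1, x2, x3, x4, x5, x6, x7].Nodup)
    (hV : ∀ v ∈ [x1, x2, x3, x4, x5, x6, x7], v ∈ V) (hq : w x2 ≤ w x1)
    (hm1 : ∀ e ∈ E, x1 ∈ e ∨ x2 ∈ e ∨ x3 ∈ e ∨ x4 ∈ e)
    (hm2 : ∀ e ∈ E, x1 ∈ e ∨ x2 ∈ e ∨ x5 ∈ e ∨ x6 ∈ e)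
    (h124 : {x1, x2, x4} ∈ E) (h126 : {x1, x2, x6} ∈ E) (h357 : {x3, x5, x7} ∈ E) :
    ∑ e ∈ E, wt w e ≤ 0.0962 := by
  classical
  simp only [List.nodup_cons, List.mem_cons, List.not_mem_nil, or_false, not_or, List.nodup_nil,
    and_true, not_false_eq_true] at hnd
  obtain ⟨⟨n12, n13, n14, n15, n16, n17⟩, ⟨n23, n24, n25, n26, n27⟩, ⟨n34, n35, n36, n37⟩,
    ⟨n45, n46, n47⟩, ⟨n56, n57⟩, n67⟩ := hnd
  simp only [List.mem_cons, List.not_mem_nil, or_false, forall_eq_or_imp, forall_eq] at hV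
  obtain ⟨v1, v2, v3, v4, v5, v6, v7⟩ := hV
  obtain ⟨T', hT'⟩ : ∃ T' : Finset ℕ, T' = V \ {x1, x2, x3, x4, x5, x6, x7} := ⟨_, rfl⟩
  have mT' : ∀ v, v ∈ T' ↔ v ∈ V ∧ v ≠ x1 ∧ v ≠ x2 ∧ v ≠ x3 ∧ v ≠ x4 ∧ v ≠ x5 ∧ v ≠ x6 ∧ v ≠ x7 := by
    intro v; rw [hT']; simp
  obtain ⟨P, hP⟩ : ∃ P, P = T'.filter (fun x => {x1, x2, x} ∈ E) := ⟨_, rfl⟩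
  obtain ⟨Y, hY⟩ : ∃ Y, Y = T'.filter (fun x => {x1, x2, x} ∉ E) := ⟨_, rfl⟩
  have mP : ∀ v, v ∈ P ↔ v ∈ T' ∧ {x1, x2, v} ∈ E := by intro v; rw [hP]; simp
  have hPY : ∀ f : ℕ → ℝ, ∑ v ∈ T', f v = ∑ v ∈ P, f v + ∑ v ∈ Y, f v := by
    intro f; rw [hP, hY]; exact (Finset.sum_filter_add_sum_filter_not _ _ _).symm
  obtain ⟨R, hR⟩ : ∃ R, R = insert x3 (insert x4 (insert x5 (insert x6 (insert x7 T')))) := ⟨_, rfl⟩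
  obtain ⟨N, hN⟩ : ∃ N, N = insert x3 (insert x4 (insert x5 (insert x6 (insert x7 P)))) := ⟨_, rfl⟩
  obtain ⟨Q, hQ⟩ : ∃ Q, Q = insert x4 (insert x6 P) := ⟨_, rfl⟩
  have sumR : ∀ f : ℕ → ℝ, ∑ v ∈ R, f v = f x3 + (f x4 + (f x5 + (f x6 + (f x7 + ∑ v ∈ T', f v)))) := by
    intro f
    rw [hR, Finset.sum_insert (by simp [mT', *]), Finset.sum_insert (by simp [mT', *]),
      Finset.sum_insert (by simp [mT', *]), Finset.sum_insert (by simp [mT', *]),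
      Finset.sum_insert (by simp [mT'])]
  have sumN : ∀ f : ℕ → ℝ, ∑ v ∈ N, f v = f x3 + (f x4 + (f x5 + (f x6 + (f x7 + ∑ v ∈ P, f v)))) := by
    intro f
    rw [hN, Finset.sum_insert (by simp [mT', mP, *]), Finset.sum_insert (by simp [mT', mP, *]),
      Finset.sum_insert (by simp [mT', mP, *]), Finset.sum_insert (by simp [mT', mP, *]),
      Finset.sum_insert (by simp [mT', mP])]
  have sumQ : ∀ f : ℕ → ℝ, ∑ v ∈ Q, f v = f x4 + (f x6 + ∑ v ∈ P, f v) := by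
    intro f
    rw [hQ, Finset.sum_insert (by simp [mT', mP, *]), Finset.sum_insert (by simp [mT', mP])]
  have mR : ∀ v, v ∈ R ↔ v ∈ V ∧ v ≠ x1 ∧ v ≠ x2 := by
    intro v
    rw [hR]
    simp only [Finset.mem_insert, mT']
    constructor
    · rintro (rfl | rfl | rfl | rfl | rfl | h)
      · exact ⟨v3, Ne.symm n13, Ne.symm n23⟩
      · exact ⟨v4, Ne.symm n14, Ne.symm n24⟩
      · exact ⟨v5, Ne.symm n15, Ne.symm n25⟩
      · exact ⟨v6, Ne.symm n16, Ne.symm n26⟩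
      · exact ⟨v7, Ne.symm n17, Ne.symm n27⟩
      · exact ⟨h.1, h.2.1, h.2.2.1⟩
    · rintro ⟨a, b, c⟩
      tauto
  have hNE : ∀ v, {x1, x2, v} ∈ E → v ∈ N := by
    intro v hv
    have hvV : v ∈ V := hsub _ hv (by simp)
    have hc := hcard _ hv
    have hv1 : v ≠ x1 := by
      rintro rfl
      have : ({v, x2, v} : Finset ℕ).card ≤ 2 := by
        rw [show ({v, x2, v} : Finset ℕ) = {v, x2} by ext; simp; tauto]; exact Finset.card_le_two
      omega
    have hv2 : v ≠ x2 := by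
      rintro rfl
      have : ({x1, v, v} : Finset ℕ).card ≤ 2 := by
        rw [show ({x1, v, v} : Finset ℕ) = {x1, v} by ext; simp]; exact Finset.card_le_two
      omega
    rw [hN]
    simp only [Finset.mem_insert, mP, mT']
    tauto
  have hQR : Q ⊆ R := by
    intro v hv
    rw [hQ] at hv
    rw [hR]
    simp only [Finset.mem_insert, mP] at hv ⊢
    tauto
  have hQ12 : ∀ u ∈ Q, {x1, x2, u} ∈ E := by
    intro u hu
    rw [hQ] at hu
    simp only [Finset.mem_insert, mP] at hu
    rcases hu with rfl | rfl | h
    · exact h124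
    · exact h126
    · exact h.2
  have hQn : ∀ u ∈ Q, u ∉ ({x3, x5, x7} : Finset ℕ) := by
    intro u hu
    rw [hQ] at hu
    simp only [Finset.mem_insert, mP, mT', Finset.mem_singleton] at hu ⊢
    rcases hu with rfl | rfl | h
    · tauto
    · tauto
    · tauto
  have hQE : ∀ u ∈ Q, ∀ v ∈ Q, u ≠ v → ¬ ({x1, u, v} ∈ E ∧ {x2, u, v} ∈ E) := by
    rintro u hu v hv _ ⟨h1, h2⟩
    rcases hK x1 x2 u v (hQ12 u hu) (hQ12 v hv) h1 h2 _ h357 with h | h | h | h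
    · simp only [Finset.mem_insert, Finset.mem_singleton] at h; tauto
    · simp only [Finset.mem_insert, Finset.mem_singleton] at h; tauto
    · exact hQn u hu h
    · exact hQn v hv h
  have main := split_bound w hw V E hsub hcard x1 x2 n12 R N Q mR hNE hQR hq hQE
  have hE0 := e0_bound w hw (E.filter fun e => x1 ∉ e ∧ x2 ∉ e) (insert x7 T') x3 x4 x5 x6
    n34 n35 n36 n45 n46 n56 (by simp [mT', *]) (by simp [mT', *]) (by simp [mT', *]) (by simp [mT', *])
    (fun e he => hcard e (Finset.mem_filter.1 he).1)
    (by
      intro e he v hv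
      simp only [Finset.mem_filter] at he
      have : v ∈ R := (mR v).2 ⟨hsub e he.1 hv, fun h => he.2.1 (h ▸ hv), fun h => he.2.2 (h ▸ hv)⟩
      rw [hR] at this
      simp only [Finset.mem_insert] at this ⊢
      tauto)
    (by
      intro e he
      simp only [Finset.mem_filter] at he
      have := hm1 e he.1
      tauto)
    (by
      intro e he
      simp only [Finset.mem_filter] at he
      have := hm2 e he.1
      tauto)
  rw [Finset.sum_insert (by simp [mT'])] at hE0
  have eR := esum2_eq w R
  have eQ := esum2_eq w Q
  rw [sumR, sumR, hPY, hPY] at eR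
  rw [sumQ, sumQ] at eQ
  rw [sumN] at main
  rw [hPY] at hE0
  have hV1 : ∑ v ∈ V, w v = w x1 + (w x2 + ∑ v ∈ R, w v) := by
    have : V = insert x1 (insert x2 R) := by
      ext v
      simp only [Finset.mem_insert, mR]
      constructor
      · intro h; tauto
      · rintro (rfl | rfl | h)
        · exact v1
        · exact v2
        · exact h.1
    rw [this, Finset.sum_insert (by simp [mR, n12]), Finset.sum_insert (by simp [mR])]
  rw [hsum, sumR, hPY] at hV1
  have z0 : 0 ≤ ∑ v ∈ P, w v := Finset.sum_nonneg fun v _ => hw v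
  have y0 : 0 ≤ ∑ v ∈ Y, w v := Finset.sum_nonneg fun v _ => hw v
  have zz0 : 0 ≤ ∑ v ∈ P, (w v)^2 := Finset.sum_nonneg fun v _ => sq_nonneg _
  have yy0 : 0 ≤ ∑ v ∈ Y, (w v)^2 := Finset.sum_nonneg fun v _ => sq_nonneg _
  have p0 := hw x1
  have q0 := hw x2
  have a3 := hw x3
  have a4 := hw x4
  have a5 := hw x5
  have a6 := hw x6
  have a7 := hw x7
  generalize (∑ v ∈ P, w v) = z at *
  generalize (∑ v ∈ Y, w v) = y at *
  generalize (∑ v ∈ P, (w v)^2) = zz at *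
  generalize (∑ v ∈ Y, (w v)^2) = yy at *
  generalize (∑ e ∈ E, wt w e) = S at *
  generalize (∑ e ∈ E with x1 ∉ e ∧ x2 ∉ e, wt w e) = S0 at *
  generalize esum2 w R = ER at *
  generalize esum2 w Q = EQ at *
  generalize w x1 = p at *
  generalize w x2 = q at *
  generalize w x3 = w3 at *
  generalize w x4 = w4 at *
  generalize w x5 = w5 at *
  generalize w x6 = w6 at *
  generalize w x7 = u at *
  clear * - main hE0 eR eQ hV1 z0 y0 zz0 yy0 p0 q0 a3 a4 a5 a6 a7 hq
  exact finI p q w3 w4 w5 w6 u z y zz yy S S0 ER EQ p0 q0 a3 a4 a5 a6 a7 z0 y0 zz0 yy0 hq hV1 eR eQ hE0 main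

/-- The case in which all edges avoiding `x1, x2` lie inside the six vertices. -/
lemma caseII (w : ℕ → ℝ) (hw : ∀ v, 0 ≤ w v) (V : Finset ℕ) (E : Finset (Finset ℕ))
    (hsub : ∀ e ∈ E, e ⊆ V) (hcard : ∀ e ∈ E, e.card = 3) (hsum : ∑ v ∈ V, w v = 1)
    (x1 x2 x3 x4 x5 x6 : ℕ) (hnd : [x1, x2, x3, x4, x5, x6].Nodup)
    (hV : ∀ v ∈ [x1, x2, x3, x4, x5, x6], v ∈ V) (hq : w x2 ≤ w x1)
    (hm1 : ∀ e ∈ E, x1 ∈ e ∨ x2 ∈ e ∨ x3 ∈ e ∨ x4 ∈ e)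
    (hm2 : ∀ e ∈ E, x1 ∈ e ∨ x2 ∈ e ∨ x5 ∈ e ∨ x6 ∈ e)
    (hin : ∀ e ∈ E, x1 ∉ e → x2 ∉ e → ∀ v ∈ e, v = x3 ∨ v = x4 ∨ v = x5 ∨ v = x6) :
    ∑ e ∈ E, wt w e ≤ Real.sqrt 3 / 18 := by
  classical
  simp only [List.nodup_cons, List.mem_cons, List.not_mem_nil, or_false, not_or, List.nodup_nil,
    and_true, not_false_eq_true] at hnd
  obtain ⟨⟨n12, n13, n14, n15, n16⟩, ⟨n23, n24, n25, n26⟩, ⟨n34, n35, n36⟩,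
    ⟨n45, n46⟩, n56⟩ := hnd
  simp only [List.mem_cons, List.not_mem_nil, or_false, forall_eq_or_imp, forall_eq] at hV
  obtain ⟨v1, v2, v3, v4, v5, v6⟩ := hV
  obtain ⟨T, hT⟩ : ∃ T : Finset ℕ, T = V \ {x1, x2, x3, x4, x5, x6} := ⟨_, rfl⟩
  have mT : ∀ v, v ∈ T ↔ v ∈ V ∧ v ≠ x1 ∧ v ≠ x2 ∧ v ≠ x3 ∧ v ≠ x4 ∧ v ≠ x5 ∧ v ≠ x6 := by
    intro v; rw [hT]; simp
  obtain ⟨R, hR⟩ : ∃ R, R = insert x3 (insert x4 (insert x5 (insert x6 T))) := ⟨_, rfl⟩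
  have sumR : ∀ f : ℕ → ℝ, ∑ v ∈ R, f v = f x3 + (f x4 + (f x5 + (f x6 + ∑ v ∈ T, f v))) := by
    intro f
    rw [hR, Finset.sum_insert (by simp [mT, *]), Finset.sum_insert (by simp [mT, *]),
      Finset.sum_insert (by simp [mT, *]), Finset.sum_insert (by simp [mT])]
  have mR : ∀ v, v ∈ R ↔ v ∈ V ∧ v ≠ x1 ∧ v ≠ x2 := by
    intro v
    rw [hR]
    simp only [Finset.mem_insert, mT]
    constructor
    · rintro (rfl | rfl | rfl | rfl | h)
      · exact ⟨v3, Ne.symm n13, Ne.symm n23⟩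
      · exact ⟨v4, Ne.symm n14, Ne.symm n24⟩
      · exact ⟨v5, Ne.symm n15, Ne.symm n25⟩
      · exact ⟨v6, Ne.symm n16, Ne.symm n26⟩
      · exact ⟨h.1, h.2.1, h.2.2.1⟩
    · rintro ⟨a, b, c⟩
      tauto
  have hNE : ∀ v, {x1, x2, v} ∈ E → v ∈ R := by
    intro v hv
    have hvV : v ∈ V := hsub _ hv (by simp)
    have hc := hcard _ hv
    have hv1 : v ≠ x1 := by
      rintro rfl
      have : ({v, x2, v} : Finset ℕ).card ≤ 2 := by
        rw [show ({v, x2, v} : Finset ℕ) = {v, x2} by ext; simp; tauto]; exact Finset.card_le_two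
      omega
    have hv2 : v ≠ x2 := by
      rintro rfl
      have : ({x1, v, v} : Finset ℕ).card ≤ 2 := by
        rw [show ({x1, v, v} : Finset ℕ) = {x1, v} by ext; simp]; exact Finset.card_le_two
      omega
    exact (mR v).2 ⟨hvV, hv1, hv2⟩
  have main := split_bound w hw V E hsub hcard x1 x2 n12 R R ∅ mR hNE (by simp) hq (by simp)
  have hE0 := e0_bound w hw (E.filter fun e => x1 ∉ e ∧ x2 ∉ e) ∅ x3 x4 x5 x6
    n34 n35 n36 n45 n46 n56 (by simp) (by simp) (by simp) (by simp)
    (fun e he => hcard e (Finset.mem_filter.1 he).1)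
    (by
      intro e he v hv
      simp only [Finset.mem_filter] at he
      exact Or.inr (hin e he.1 he.2.1 he.2.2 v hv))
    (by
      intro e he
      simp only [Finset.mem_filter] at he
      have := hm1 e he.1
      tauto)
    (by
      intro e he
      simp only [Finset.mem_filter] at he
      have := hm2 e he.1
      tauto)
  have eR := esum2_eq w R
  have eQ := esum2_eq w ∅
  simp only [Finset.sum_empty] at eQ hE0
  have hV1 : ∑ v ∈ V, w v = w x1 + (w x2 + ∑ v ∈ R, w v) := by
    have : V = insert x1 (insert x2 R) := by
      ext v
      simp only [Finset.mem_insert, mR]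
      constructor
      · intro h; tauto
      · rintro (rfl | rfl | h)
        · exact v1
        · exact v2
        · exact h.1
    rw [this, Finset.sum_insert (by simp [mR, n12]), Finset.sum_insert (by simp [mR])]
  rw [hsum] at hV1
  rw [sumR, sumR] at eR
  rw [sumR] at hV1 main
  have t0 : 0 ≤ ∑ v ∈ T, w v := Finset.sum_nonneg fun v _ => hw v
  have tt0 : 0 ≤ ∑ v ∈ T, (w v)^2 := Finset.sum_nonneg fun v _ => sq_nonneg _
  have eQ0 : esum2 w ∅ = 0 := by linarith
  rw [eQ0] at main
  exact finII (w x1) (w x2) (w x3) (w x4) (w x5) (w x6) _ _ _ _ _ (hw _) (hw _) (hw _) (hw _)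
    (hw _) (hw _) t0 tt0 hV1 eR hE0 main

lemma bound_aux (w : ℕ → ℝ) (hw : ∀ v, 0 ≤ w v) (V : Finset ℕ) (E : Finset (Finset ℕ))
    (hsub : ∀ e ∈ E, e ⊆ V) (hcard : ∀ e ∈ E, e.card = 3) (hsum : ∑ v ∈ V, w v = 1)
    (hK : ∀ a b c d, {a, b, c} ∈ E → {a, b, d} ∈ E → {a, c, d} ∈ E → {b, c, d} ∈ E →
      ∀ e ∈ E, a ∈ e ∨ b ∈ e ∨ c ∈ e ∨ d ∈ e)
    (x1 x2 x3 x4 x5 x6 : ℕ) (hnd : [x1, x2, x3, x4, x5, x6].Nodup)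
    (hV : ∀ v ∈ [x1, x2, x3, x4, x5, x6], v ∈ V) (hq : w x2 ≤ w x1)
    (hm1 : ∀ e ∈ E, x1 ∈ e ∨ x2 ∈ e ∨ x3 ∈ e ∨ x4 ∈ e)
    (hm2 : ∀ e ∈ E, x1 ∈ e ∨ x2 ∈ e ∨ x5 ∈ e ∨ x6 ∈ e)
    (h123 : {x1, x2, x3} ∈ E) (h124 : {x1, x2, x4} ∈ E) (h125 : {x1, x2, x5} ∈ E)
    (h126 : {x1, x2, x6} ∈ E) :
    ∑ e ∈ E, wt w e ≤ Real.sqrt 3 / 18 := by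
  by_cases h : ∃ e ∈ E, x1 ∉ e ∧ x2 ∉ e ∧ ∃ v ∈ e, ¬ (v = x3 ∨ v = x4 ∨ v = x5 ∨ v = x6)
  · have h962 : (0.0962 : ℝ) ≤ Real.sqrt 3 / 18 := by
      have : (1.7316 : ℝ) ≤ Real.sqrt 3 := Real.le_sqrt_of_sq_le (by norm_num)
      linarith
    refine le_trans ?_ h962
    obtain ⟨e, he, h1, h2, v, hve, hv⟩ := h
    have hv1 : v ≠ x1 := by rintro rfl; exact h1 hve
    have hv2 : v ≠ x2 := by rintro rfl; exact h2 hve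
    have hvV : v ∈ V := hsub e he hve
    have e1 := hm1 e he
    have e2 := hm2 e he
    have hc := hcard e he
    have hm1' : ∀ e ∈ E, x1 ∈ e ∨ x2 ∈ e ∨ x4 ∈ e ∨ x3 ∈ e := by
      intro e he; have := hm1 e he; tauto
    have hm2' : ∀ e ∈ E, x1 ∈ e ∨ x2 ∈ e ∨ x6 ∈ e ∨ x5 ∈ e := by
      intro e he; have := hm2 e he; tauto
    simp only [List.nodup_cons, List.mem_cons, List.not_mem_nil, or_false, not_or, List.nodup_nil,
      and_true, not_false_eq_true] at hnd
    obtain ⟨⟨n12, n13, n14, n15, n16⟩, ⟨n23, n24, n25, n26⟩, ⟨n34, n35, n36⟩,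
      ⟨n45, n46⟩, n56⟩ := hnd
    simp only [List.mem_cons, List.not_mem_nil, or_false, forall_eq_or_imp, forall_eq] at hV
    obtain ⟨v1, v2, v3, v4, v5, v6⟩ := hV
    simp only [not_or] at hv
    obtain ⟨k3, k4, k5, k6⟩ := hv
    have e1' : x3 ∈ e ∨ x4 ∈ e := (e1.resolve_left h1).resolve_left h2
    have e2' : x5 ∈ e ∨ x6 ∈ e := (e2.resolve_left h1).resolve_left h2
    rcases e1' with c1 | c1 <;> rcases e2' with c2 | c2
    · have := triple_eq e hc _ _ v c1 c2 hve (by assumption) (Ne.symm k3) (Ne.symm k5)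
      exact caseI w hw V E hsub hcard hsum hK x1 x2 x3 x4 x5 x6 v
        (by
          simp only [List.nodup_cons, List.mem_cons, List.not_mem_nil, or_false, not_or, List.nodup_nil,
            and_true, not_false_eq_true]
          refine ⟨⟨?_, ?_, ?_, ?_, ?_, ?_⟩, ⟨?_, ?_, ?_, ?_, ?_⟩, ⟨?_, ?_, ?_, ?_⟩, ⟨?_, ?_, ?_⟩,
            ⟨?_, ?_⟩, ?_⟩ <;> first | assumption | (apply Ne.symm; assumption))
        (by
          simp only [List.mem_cons, List.not_mem_nil, or_false, forall_eq_or_imp, forall_eq]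
          refine ⟨?_, ?_, ?_, ?_, ?_, ?_, ?_⟩ <;> assumption) hq hm1 hm2 h124 h126 (this ▸ he)
    · have := triple_eq e hc _ _ v c1 c2 hve (by assumption) (Ne.symm k3) (Ne.symm k6)
      exact caseI w hw V E hsub hcard hsum hK x1 x2 x3 x4 x6 x5 v
        (by
          simp only [List.nodup_cons, List.mem_cons, List.not_mem_nil, or_false, not_or, List.nodup_nil,
            and_true, not_false_eq_true]
          refine ⟨⟨?_, ?_, ?_, ?_, ?_, ?_⟩, ⟨?_, ?_, ?_, ?_, ?_⟩, ⟨?_, ?_, ?_, ?_⟩, ⟨?_, ?_, ?_⟩,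
            ⟨?_, ?_⟩, ?_⟩ <;> first | assumption | (apply Ne.symm; assumption))
        (by
          simp only [List.mem_cons, List.not_mem_nil, or_false, forall_eq_or_imp, forall_eq]
          refine ⟨?_, ?_, ?_, ?_, ?_, ?_, ?_⟩ <;> assumption) hq hm1 hm2' h124 h125 (this ▸ he)
    · have := triple_eq e hc _ _ v c1 c2 hve (by assumption) (Ne.symm k4) (Ne.symm k5)
      exact caseI w hw V E hsub hcard hsum hK x1 x2 x4 x3 x5 x6 v
        (by
          simp only [List.nodup_cons, List.mem_cons, List.not_mem_nil, or_false, not_or, List.nodup_nil,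
            and_true, not_false_eq_true]
          refine ⟨⟨?_, ?_, ?_, ?_, ?_, ?_⟩, ⟨?_, ?_, ?_, ?_, ?_⟩, ⟨?_, ?_, ?_, ?_⟩, ⟨?_, ?_, ?_⟩,
            ⟨?_, ?_⟩, ?_⟩ <;> first | assumption | (apply Ne.symm; assumption))
        (by
          simp only [List.mem_cons, List.not_mem_nil, or_false, forall_eq_or_imp, forall_eq]
          refine ⟨?_, ?_, ?_, ?_, ?_, ?_, ?_⟩ <;> assumption) hq hm1' hm2 h123 h126 (this ▸ he)
    · have := triple_eq e hc _ _ v c1 c2 hve (by assumption) (Ne.symm k4) (Ne.symm k6)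
      exact caseI w hw V E hsub hcard hsum hK x1 x2 x4 x3 x6 x5 v
        (by
          simp only [List.nodup_cons, List.mem_cons, List.not_mem_nil, or_false, not_or, List.nodup_nil,
            and_true, not_false_eq_true]
          refine ⟨⟨?_, ?_, ?_, ?_, ?_, ?_⟩, ⟨?_, ?_, ?_, ?_, ?_⟩, ⟨?_, ?_, ?_, ?_⟩, ⟨?_, ?_, ?_⟩,
            ⟨?_, ?_⟩, ?_⟩ <;> first | assumption | (apply Ne.symm; assumption))
        (by
          simp only [List.mem_cons, List.not_mem_nil, or_false, forall_eq_or_imp, forall_eq]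
          refine ⟨?_, ?_, ?_, ?_, ?_, ?_, ?_⟩ <;> assumption) hq hm1' hm2' h123 h125 (this ▸ he)
  · push Not at h
    exact caseII w hw V E hsub hcard hsum x1 x2 x3 x4 x5 x6 hnd hV hq hm1 hm2
      (fun e he h1 h2 v hv => h e he h1 h2 v hv)

lemma hK_of_free (G : ThreeGraph) (hfree : G.Free K43e) :
    ∀ a b c d, {a, b, c} ∈ G.edges → {a, b, d} ∈ G.edges → {a, c, d} ∈ G.edges →
      {b, c, d} ∈ G.edges → ∀ e ∈ G.edges, a ∈ e ∨ b ∈ e ∨ c ∈ e ∨ d ∈ e := by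
  intro a b c d h1 h2 h3 h4 e he
  by_contra hcon
  push Not at hcon
  obtain ⟨ha, hb, hc, hd⟩ := hcon
  obtain ⟨y5, y6, y7, h56, h57, h67, rfl⟩ := Finset.card_eq_three.1 (G.card_eq e he)
  have tri : ∀ x y z : ℕ, ({x, y, z} : Finset ℕ).card = 3 → x ≠ y ∧ x ≠ z ∧ y ≠ z := by
    intro x y z h
    refine ⟨?_, ?_, ?_⟩
    · rintro rfl
      have : ({x, x, z} : Finset ℕ).card ≤ 2 := by
        rw [Finset.insert_eq_of_mem (by simp)]; exact Finset.card_le_two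
      omega
    · rintro rfl
      have : ({x, y, x} : Finset ℕ).card ≤ 2 := by
        rw [Finset.insert_eq_of_mem (by simp)]; exact Finset.card_le_two
      omega
    · rintro rfl
      have : ({x, y, y} : Finset ℕ).card ≤ 2 := by
        rw [Finset.pair_eq_singleton]; exact Finset.card_le_two
      omega
  obtain ⟨nab, nac, nbc⟩ := tri _ _ _ (G.card_eq _ h1)
  obtain ⟨_, nad, nbd⟩ := tri _ _ _ (G.card_eq _ h2)
  obtain ⟨_, _, ncd⟩ := tri _ _ _ (G.card_eq _ h3)
  simp only [Finset.mem_insert, Finset.mem_singleton, not_or] at ha hb hc hd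
  obtain ⟨a5, a6, a7⟩ := ha
  obtain ⟨b5, b6, b7⟩ := hb
  obtain ⟨c5, c6, c7⟩ := hc
  obtain ⟨d5, d6, d7⟩ := hd
  have s1 := G.edges_sub _ h1
  have s4 := G.edges_sub _ h4
  have s5 := G.edges_sub _ he
  apply hfree
  refine ⟨fun n => if n = 1 then a else if n = 2 then b else if n = 3 then c else if n = 4 then d
    else if n = 5 then y5 else if n = 6 then y6 else y7, ?_, ?_, ?_⟩
  · intro i hi j hj hij
    simp only [K43e, Finset.coe_insert, Finset.coe_singleton, Set.mem_insert_iff,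
      Set.mem_singleton_iff] at hi hj
    rcases hi with rfl | rfl | rfl | rfl | rfl | rfl | rfl <;>
    rcases hj with rfl | rfl | rfl | rfl | rfl | rfl | rfl <;>
    first
    | rfl
    | (exfalso; norm_num at hij; first | exact absurd hij (by assumption) | exact absurd hij.symm (by assumption))
  · intro i hi
    simp only [K43e, Finset.mem_insert, Finset.mem_singleton] at hi
    rcases hi with rfl | rfl | rfl | rfl | rfl | rfl | rfl
    · exact s1 (by simp)
    · exact s1 (by simp)
    · exact s1 (by simp)
    · exact s4 (by simp)
    · exact s5 (by simp)
    · exact s5 (by simp)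
    · exact s5 (by simp)
  · intro e' he'
    simp only [K43e, Finset.mem_insert, Finset.mem_singleton] at he'
    rcases he' with rfl | rfl | rfl | rfl | rfl <;>
    simp only [Finset.image_insert, Finset.image_singleton] <;> norm_num <;> assumption

lemma lagFun_le (G : ThreeGraph) (hfree : G.Free K43e) (hX : G.ContainsCopy X2) (w₀ : ℕ → ℝ)
    (hw₀ : G.IsFeasible w₀) : G.lagFun w₀ ≤ Real.sqrt 3 / 18 := by
  obtain ⟨w, hw⟩ : ∃ w : ℕ → ℝ, w = fun v => if v ∈ G.verts then w₀ v else 0 := ⟨_, rfl⟩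
  have hwe : ∀ v ∈ G.verts, w₀ v = w v := by intro v hv; rw [hw]; simp [hv]
  have hnn : ∀ v, 0 ≤ w v := by
    intro v
    by_cases hv : v ∈ G.verts
    · rw [← hwe v hv]; exact hw₀.1 v hv
    · rw [hw]; simp [hv]
  have hsum : ∑ v ∈ G.verts, w v = 1 := by
    rw [← hw₀.2]; exact Finset.sum_congr rfl fun v hv => (hwe v hv).symm
  have hlf : G.lagFun w₀ = ∑ e ∈ G.edges, wt w e := by
    unfold HyperGraph.lagFun wt
    exact Finset.sum_congr rfl fun e he =>
      Finset.prod_congr rfl fun v hv => hwe v (G.edges_sub e he hv)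
  rw [hlf]
  have hK := hK_of_free G hfree
  obtain ⟨f, hinj, hfv, hfe⟩ := hX
  have ne : ∀ i ∈ X2.verts, ∀ j ∈ X2.verts, i ≠ j → f i ≠ f j :=
    fun i hi j hj hij h => hij (hinj hi hj h)
  have him : ∀ i j k : ℕ, ({i, j, k} : Finset ℕ).image f = {f i, f j, f k} := by
    intro i j k; simp only [Finset.image_insert, Finset.image_singleton]
  have e123 : {f 1, f 2, f 3} ∈ G.edges := by rw [← him]; exact hfe _ (by decide)
  have e124 : {f 1, f 2, f 4} ∈ G.edges := by rw [← him]; exact hfe _ (by decide)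
  have e134 : {f 1, f 3, f 4} ∈ G.edges := by rw [← him]; exact hfe _ (by decide)
  have e234 : {f 2, f 3, f 4} ∈ G.edges := by rw [← him]; exact hfe _ (by decide)
  have e125 : {f 1, f 2, f 5} ∈ G.edges := by rw [← him]; exact hfe _ (by decide)
  have e126 : {f 1, f 2, f 6} ∈ G.edges := by rw [← him]; exact hfe _ (by decide)
  have e156 : {f 1, f 5, f 6} ∈ G.edges := by rw [← him]; exact hfe _ (by decide)
  have e256 : {f 2, f 5, f 6} ∈ G.edges := by rw [← him]; exact hfe _ (by decide)
  have hm1 := hK _ _ _ _ e123 e124 e134 e234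
  have hm2 := hK _ _ _ _ e125 e126 e156 e256
  have hnd : [f 1, f 2, f 3, f 4, f 5, f 6].Nodup := by
    simp only [List.nodup_cons, List.mem_cons, List.not_mem_nil, or_false, not_or, List.nodup_nil,
      and_true, not_false_eq_true]
    refine ⟨⟨?_, ?_, ?_, ?_, ?_⟩, ⟨?_, ?_, ?_, ?_⟩, ⟨?_, ?_, ?_⟩, ⟨?_, ?_⟩, ?_⟩ <;>
    exact ne _ (by decide) _ (by decide) (by decide)
  have hnd' : [f 2, f 1, f 3, f 4, f 5, f 6].Nodup := by
    simp only [List.nodup_cons, List.mem_cons, List.not_mem_nil, or_false, not_or, List.nodup_nil,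
      and_true, not_false_eq_true]
    refine ⟨⟨?_, ?_, ?_, ?_, ?_⟩, ⟨?_, ?_, ?_, ?_⟩, ⟨?_, ?_, ?_⟩, ⟨?_, ?_⟩, ?_⟩ <;>
    exact ne _ (by decide) _ (by decide) (by decide)
  have hV : ∀ v ∈ [f 1, f 2, f 3, f 4, f 5, f 6], v ∈ G.verts := by
    simp only [List.mem_cons, List.not_mem_nil, or_false, forall_eq_or_imp, forall_eq]
    refine ⟨?_, ?_, ?_, ?_, ?_, ?_⟩ <;> exact hfv _ (by decide)
  have hV' : ∀ v ∈ [f 2, f 1, f 3, f 4, f 5, f 6], v ∈ G.verts := by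
    simp only [List.mem_cons, List.not_mem_nil, or_false, forall_eq_or_imp, forall_eq]
    refine ⟨?_, ?_, ?_, ?_, ?_, ?_⟩ <;> exact hfv _ (by decide)
  rcases le_total (w (f 2)) (w (f 1)) with hq | hq
  · exact bound_aux w hnn G.verts G.edges G.edges_sub G.card_eq hsum hK _ _ _ _ _ _ hnd hV hq
      hm1 hm2 e123 e124 e125 e126
  · rw [Finset.insert_comm] at e123 e124 e125 e126
    exact bound_aux w hnn G.verts G.edges G.edges_sub G.card_eq hsum hK _ _ _ _ _ _ hnd' hV' hq
      (fun e he => or_left_comm.1 (hm1 e he)) (fun e he => or_left_comm.1 (hm2 e he))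
      e123 e124 e125 e126

/-- A dense `K_4^3 ∪ e`-free 3-graph with Lagrangian greater than `√3/18` is `X_2`-free. -/
theorem dense_K43e_free_X2_free (G : ThreeGraph) (hdense : G.LagDense)
    (hfree : G.Free K43e) (hlag : Real.sqrt 3 / 18 < G.lag) : G.Free X2 := by
  intro hX
  refine absurd hlag (not_lt.2 ?_)
  unfold HyperGraph.lag
  apply Real.sSup_le
  · rintro x ⟨w, hw, rfl⟩
    exact lagFun_le G hfree hX w hw
  · positivity
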